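/- Let S = {−1,0,1}²∖{(0,0)} be the full set of eight short steps (Model 3). Then G_S(t;a,1) ∈ ℚ[a][[t]] and G_S(t;1,b) ∈ ℚ[b][[t]] are D-finite, and there exist D-finite power series F, H ∈ ℚ[a,b][[t]] with H ≠ 0 such that H·G_S(t;a,b) = F. -/

import Mathlib

open PowerSeries

/-- A quarter-plane loop of length `n` with steps in `S`: a sequence of points of
`ℤ≥0 × ℤ≥0` (encoded as `ℕ × ℕ`) starting and ending at the origin, with successive
differences in `S`. -/
def IsQPLoop (S : Set (ℤ × ℤ)) (n : ℕ) (w : Fin (n + 1) → ℕ × ℕ) : Prop :=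
  w 0 = (0, 0) ∧ w (Fin.last n) = (0, 0) ∧
    ∀ i : Fin n, (((w i.succ).1 : ℤ) - ((w i.castSucc).1 : ℤ),
      ((w i.succ).2 : ℤ) - ((w i.castSucc).2 : ℤ)) ∈ S

/-- The number of visits of `w` to the horizontal boundary: indices `1 ≤ i ≤ n`
with the second coordinate of `w i` equal to `0`. -/
def hvisits {n : ℕ} (w : Fin (n + 1) → ℕ × ℕ) : ℕ :=
  (Finset.univ.filter fun i : Fin (n + 1) => 0 < (i : ℕ) ∧ (w i).2 = 0).card

/-- The number of visits of `w` to the vertical boundary: indices `1 ≤ i ≤ n`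
with the first coordinate of `w i` equal to `0`. -/
def vvisits {n : ℕ} (w : Fin (n + 1) → ℕ × ℕ) : ℕ :=
  (Finset.univ.filter fun i : Fin (n + 1) => 0 < (i : ℕ) ∧ (w i).1 = 0).card

/-- The interacting generating function `G_S(t;a,b) = Σ_n t^n Σ_w a^(h(w)) b^(v(w))`,
the inner sum over all quarter-plane loops of length `n` with steps in `S`. -/
noncomputable def loopGF (S : Set (ℤ × ℤ)) {R : Type*} [CommRing R] (a b : R) :
    PowerSeries R :=
  PowerSeries.mk fun n =>
    ∑ᶠ w : {w : Fin (n + 1) → ℕ × ℕ // IsQPLoop S n w}, a ^ hvisits w.1 * b ^ vvisits w.1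

/-- A power series `F ∈ R[[t]]` is D-finite if there are polynomials `p₀, …, p_m`,
not all zero, with `Σ pᵢ · F⁽ⁱ⁾ = 0`, where `F⁽ⁱ⁾` is the `i`-th formal derivative. -/
def IsDFinite {R : Type*} [CommRing R] (F : PowerSeries R) : Prop :=
  ∃ (m : ℕ) (p : Fin (m + 1) → Polynomial R), (∃ i, p i ≠ 0) ∧
    ∑ i : Fin (m + 1), (p i : PowerSeries R) * (PowerSeries.derivativeFun)^[(i : ℕ)] F = 0

section PolySpan

variable {K L ι : Type*} [CommRing K] [CommRing L] [Algebra K L]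

/-- The `K`-span of the products `ε k * x ^ m` with `m ≤ d`. -/
def polySpan (K : Type*) {L ι : Type*} [CommRing K] [CommRing L] [Algebra K L]
    (x : L) (ε : ι → L) (d : ℕ) : Submodule K L :=
  Submodule.span K (Set.range fun p : ι × Fin (d + 1) => ε p.1 * x ^ (p.2 : ℕ))

/-- Polynomials in `x` of degree at most `d` with coefficients in `K`. -/
abbrev polyLE (K : Type*) {L : Type*} [CommRing K] [CommRing L] [Algebra K L]
    (x : L) (d : ℕ) : Submodule K L :=
  polySpan K x (fun _ : Unit => (1 : L)) d

theorem mem_polySpan_gen {x : L} {ε : ι → L} {d m : ℕ} (k : ι) (h : m ≤ d) :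
    ε k * x ^ m ∈ polySpan K x ε d :=
  Submodule.subset_span ⟨(k, ⟨m, Nat.lt_succ_of_le h⟩), rfl⟩

theorem polySpan_mono {x : L} {ε : ι → L} {d e : ℕ} (h : d ≤ e) :
    polySpan K x ε d ≤ polySpan K x ε e := by
  refine Submodule.span_le.2 ?_
  rintro _ ⟨⟨k, m⟩, rfl⟩
  exact mem_polySpan_gen k (by have := m.2; omega)

theorem mul_mem_polySpan {x : L} {ε : ι → L} {d e : ℕ} {f g : L}
    (hf : f ∈ polySpan K x ε d) (hg : g ∈ polyLE K x e) : f * g ∈ polySpan K x ε (d + e) := by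
  have h : polySpan K x ε d * polyLE K x e ≤ polySpan K x ε (d + e) := by
    rw [polySpan, polyLE, polySpan, Submodule.span_mul_span, Submodule.span_le]
    rintro _ ⟨_, ⟨⟨k, m⟩, rfl⟩, _, ⟨⟨_, l⟩, rfl⟩, rfl⟩
    have := mem_polySpan_gen (K := K) (x := x) (ε := ε) (d := d + e) (m := m + l) k
      (by have := m.2; have := l.2; omega)
    simpa [pow_add, mul_assoc] using this
  exact h (Submodule.mul_mem_mul hf hg)

/-- Additive maps satisfying the Leibniz rule. -/
structure IsDeriv (D : L → L) : Prop where
  map_add : ∀ f g, D (f + g) = D f + D g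
  leibniz : ∀ f g, D (f * g) = f * D g + g * D f

namespace IsDeriv

variable {D : L → L}

theorem map_zero (hD : IsDeriv D) : D 0 = 0 := by
  simpa using hD.map_add 0 0

theorem map_one (hD : IsDeriv D) : D 1 = 0 := by
  simpa using hD.leibniz 1 1

theorem leibniz_pow (hD : IsDeriv D) (f : L) (n : ℕ) : D (f ^ n) = n * (f ^ (n - 1) * D f) := by
  induction n with
  | zero => simp [hD.map_one]
  | succ n ih =>
    rw [pow_succ, hD.leibniz, ih]
    rcases n with _ | n
    · simp
    · simp only [Nat.add_sub_cancel]; push_cast; ring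

end IsDeriv

/-- The derivation `D` of `L` maps constants of `K` into `K`, `x` into `K`, and `ε k` into
`Q⁻¹ (⨁ K[x] ε l)` with degrees bounded by `d`. -/
structure CompatDerivation (K : Type*) {L ι : Type*} [CommRing K] [CommRing L] [Algebra K L]
    (x : L) (ε : ι → L) (Q : L) (d : ℕ) (D : L → L) : Prop extends IsDeriv D where
  map_const : ∀ k : K, ∃ k' : K, D (algebraMap K L k) = algebraMap K L k'
  map_x : ∃ k' : K, D x = algebraMap K L k'
  map_basis : ∀ k, Q * D (ε k) ∈ polySpan K x ε d

theorem CompatDerivation.mul_map_mem {x : L} {ε : ι → L} {Q : L} {d e : ℕ}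
    {D : L → L} (hD : CompatDerivation K x ε Q d D) (hQ : Q ∈ polyLE K x d)
    {f : L} (hf : f ∈ polySpan K x ε e) : Q * D f ∈ polySpan K x ε (e + d) := by
  induction hf using Submodule.span_induction with
  | mem f hf =>
    obtain ⟨⟨k, m⟩, rfl⟩ := hf
    obtain ⟨c, hc⟩ := hD.map_x
    have hm : (m : ℕ) ≤ e := by have := m.2; omega
    have h1 : Q * D (ε k) * x ^ (m : ℕ) ∈ polySpan K x ε (d + e) :=
      mul_mem_polySpan (hD.map_basis k)
        (by simpa using mem_polySpan_gen (K := K) (x := x) (ε := fun _ : Unit => (1 : L)) () hm)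
    have h2 : ε k * x ^ ((m : ℕ) - 1) * Q ∈ polySpan K x ε (e + d) :=
      mul_mem_polySpan (mem_polySpan_gen k (by omega)) hQ
    have h3 := Submodule.smul_mem _ (((m : ℕ) : K) * c) h2
    rw [add_comm d e] at h1
    convert add_mem h1 h3 using 1
    rw [Algebra.smul_def]
    simp only [hD.leibniz, hD.leibniz_pow, hc, map_mul, map_natCast]
    ring
  | zero => simp [hD.map_zero]
  | add f g _ _ hf hg => rw [hD.map_add, mul_add]; exact add_mem hf hg
  | smul c f hf' hf =>
    obtain ⟨c', hc⟩ := hD.map_const c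
    have h2 := Submodule.smul_mem _ c' (mul_mem_polySpan hf' hQ)
    convert add_mem (Submodule.smul_mem _ c hf) h2 using 1
    simp only [Algebra.smul_def (A := L) c, Algebra.smul_def (A := L) c', hD.leibniz, hc]
    ring

theorem CompatDerivation.pow_mul_map_mem {x : L} {ε : ι → L} {Q : L} {d n : ℕ}
    {D : L → L} (hD : CompatDerivation K x ε Q d D) (hQ : Q ∈ polyLE K x d)
    {f : L} (hf : Q ^ (n + 1) * f ∈ polySpan K x ε (d * (n + 1))) :
    Q ^ (n + 2) * D f ∈ polySpan K x ε (d * (n + 2)) := by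
  have hQ' : D Q ∈ polyLE K x d := by
    have h1 : CompatDerivation K x (fun _ : Unit => (1 : L)) 1 0 D :=
      ⟨hD.toIsDeriv, hD.map_const, hD.map_x, fun _ => by simp [hD.map_one]⟩
    have h2 : (1 : L) ∈ polyLE K x 0 := by
      simpa using mem_polySpan_gen (K := K) (x := x) (ε := fun _ : Unit => (1 : L)) (d := 0) ()
        le_rfl
    simpa using h1.mul_map_mem h2 hQ
  have h1 := hD.mul_map_mem hQ hf
  have h2 := Submodule.smul_mem _ ((n : K) + 1) (mul_mem_polySpan hf hQ')
  have h3 := sub_mem h1 h2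
  rw [show d * (n + 1) + d = d * (n + 2) by ring] at h3
  convert h3 using 1
  rw [Algebra.smul_def]
  simp only [hD.leibniz, hD.leibniz_pow, map_add, map_natCast, map_one,
    Nat.add_sub_cancel, Nat.cast_add, Nat.cast_one]
  ring

theorem CompatDerivation.pow_mul_iterate_mem {x : L} {ε : ι → L} {Q : L} {d : ℕ}
    {D : L → L} (hD : CompatDerivation K x ε Q d D) (hQ : Q ∈ polyLE K x d) (m : ℕ) :
    ∀ {n : ℕ} {f : L}, Q ^ (n + 1) * f ∈ polySpan K x ε (d * (n + 1)) →
      Q ^ (n + m + 1) * D^[m] f ∈ polySpan K x ε (d * (n + m + 1)) := by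
  induction m with
  | zero => intro n f hf; simpa using hf
  | succ m ih =>
    intro n f hf
    rw [Function.iterate_succ_apply, show n + (m + 1) + 1 = n + 1 + m + 1 by ring]
    exact ih (hD.pow_mul_map_mem hQ hf)

/-- Dimension count: a nontrivial `K`-linear relation between the mixed derivatives of `F`. -/
theorem exists_relation [Nontrivial K] [IsDomain L] [Fintype ι] {x : L} {ε : ι → L} {Q : L}
    {d : ℕ} {D₁ D₂ : L → L} (h₁ : CompatDerivation K x ε Q d D₁)
    (h₂ : CompatDerivation K x ε Q d D₂) (hQ0 : Q ≠ 0) (hQ : Q ∈ polyLE K x d) {F : L}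
    (hF : Q * F ∈ polySpan K x ε d) :
    ∃ (N : ℕ) (c : Fin N × Fin N → K), c ≠ 0 ∧
      ∑ p : Fin N × Fin N, c p • D₁^[(p.1 : ℕ)] (D₂^[(p.2 : ℕ)] F) = 0 := by
  set r := Fintype.card ι
  obtain ⟨N, hN⟩ : ∃ N : ℕ, r * (d * (2 * N + 1) + 1) < N * N := by
    refine ⟨r * (3 * d + 1) + 1, ?_⟩
    set N := r * (3 * d + 1) + 1 with hNdef
    have hN1 : 1 ≤ N := by omega
    calc r * (d * (2 * N + 1) + 1) ≤ r * (d * (2 * N + N) + N) := by gcongr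
      _ = (r * (3 * d + 1)) * N := by ring
      _ < N * N := Nat.mul_lt_mul_of_pos_right (by omega) hN1
  have key : ∀ p : Fin N × Fin N, Q ^ (2 * N + 1) * D₁^[(p.1 : ℕ)] (D₂^[(p.2 : ℕ)] F) ∈
      polySpan K x ε (d * (2 * N + 1)) := by
    intro p
    have h0 : Q ^ (0 + 1) * F ∈ polySpan K x ε (d * (0 + 1)) := by simpa using hF
    have hm := h₁.pow_mul_iterate_mem hQ p.1 (h₂.pow_mul_iterate_mem hQ p.2 h0)
    have hpow : ∀ k, Q ^ k ∈ polyLE K x (d * k) := by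
      intro k
      induction k with
      | zero =>
        simpa using mem_polySpan_gen (K := K) (x := x) (ε := fun _ : Unit => (1 : L)) (d := 0) ()
          le_rfl
      | succ k ih => rw [pow_succ, mul_add, mul_one]; exact mul_mem_polySpan ih hQ
    have hle : 0 + (p.2 : ℕ) + p.1 + 1 ≤ 2 * N + 1 := by
      have := p.1.2; have := p.2.2; omega
    obtain ⟨k, hk⟩ := Nat.exists_eq_add_of_le hle
    have := mul_mem_polySpan hm (hpow k)
    rw [hk, mul_add d, pow_add Q _ k]
    convert this using 1
    ring
  have hdep : ¬ LinearIndependent K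
      fun p : Fin N × Fin N => Q ^ (2 * N + 1) * D₁^[(p.1 : ℕ)] (D₂^[(p.2 : ℕ)] F) := by
    intro hli
    classical
    have hc := linearIndependent_le_span_aux' _ hli
      (Finset.univ.image fun p : ι × Fin (d * (2 * N + 1) + 1) => ε p.1 * x ^ (p.2 : ℕ))
      (by
        rintro _ ⟨p, rfl⟩
        simpa [polySpan] using key p)
    have hc2 := hc.trans ((Fintype.card_coe _).le.trans Finset.card_image_le)
    simp only [Finset.card_univ, Fintype.card_prod, Fintype.card_fin] at hc2
    exact absurd hc2 (not_le.2 hN)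
  rw [Fintype.linearIndependent_iff] at hdep
  push Not at hdep
  obtain ⟨c, hc, p, hp⟩ := hdep
  refine ⟨N, c, fun h => hp (by simp [h]), ?_⟩
  simp only [← mul_smul_comm, ← Finset.mul_sum] at hc
  exact (mul_eq_zero.1 hc).resolve_left (pow_ne_zero _ hQ0)

end PolySpan

section LaurentPowerSeries

variable {R : Type*} [CommRing R]

/-- The Euler operator `x d/dx` on Laurent series. -/
noncomputable def laurentEuler (f : LaurentSeries R) : LaurentSeries R :=
  ⟨fun n => n • f.coeff n, f.isPWO_support.mono fun n hn h => hn (by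
    simp [show f.coeff n = 0 from h])⟩

theorem coeff_laurentEuler (f : LaurentSeries R) (n : ℤ) :
    (laurentEuler f).coeff n = n • f.coeff n := rfl

theorem isDeriv_laurentEuler : IsDeriv (laurentEuler (R := R)) where
  map_add f g := by ext n; simp [coeff_laurentEuler]
  leibniz f g := by
    have hs : ∀ h : LaurentSeries R, (laurentEuler h).support ⊆ h.support :=
      fun h n hn h' => hn (by simp [coeff_laurentEuler, show h.coeff n = 0 from h'])
    ext n
    rw [HahnSeries.coeff_add, coeff_laurentEuler, mul_comm g, HahnSeries.coeff_mul,
      HahnSeries.coeff_mul_right' g.isPWO_support (hs g),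
      HahnSeries.coeff_mul_left' f.isPWO_support (hs f), Finset.smul_sum,
      ← Finset.sum_add_distrib]
    refine Finset.sum_congr rfl fun p hp => ?_
    rw [← (Finset.mem_antidiagonal.1 hp).2.2, coeff_laurentEuler, coeff_laurentEuler, add_smul,
      mul_smul_comm, smul_mul_assoc, add_comm]

/-- The derivative `d/dx` on Laurent series. -/
noncomputable def laurentDeriv (f : LaurentSeries R) : LaurentSeries R :=
  HahnSeries.single (-1 : ℤ) (1 : R) * laurentEuler f

theorem coeff_laurentDeriv (f : LaurentSeries R) (n : ℤ) :
    (laurentDeriv f).coeff n = (n + 1 : ℤ) • f.coeff (n + 1) := by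
  have h := HahnSeries.coeff_single_mul_add (r := (1 : R)) (x := laurentEuler f)
    (a := n + 1) (b := -1)
  rwa [add_neg_cancel_right, one_mul, coeff_laurentEuler] at h

theorem isDeriv_laurentDeriv : IsDeriv (laurentDeriv (R := R)) where
  map_add f g := by rw [laurentDeriv, isDeriv_laurentEuler.map_add, mul_add]; rfl
  leibniz f g := by simp only [laurentDeriv, isDeriv_laurentEuler.leibniz]; ring

/-- The derivation `∂/∂t` on `R((x))[[t]]`. -/
noncomputable def derivT (f : (LaurentSeries R)⟦X⟧) : (LaurentSeries R)⟦X⟧ :=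
  d⁄dX (LaurentSeries R) f

theorem isDeriv_derivT : IsDeriv (derivT (R := R)) where
  map_add f g := by simp [derivT]
  leibniz f g := by simp [derivT]

/-- The derivation `∂/∂x` on `R((x))[[t]]`. -/
noncomputable def derivX (f : (LaurentSeries R)⟦X⟧) : (LaurentSeries R)⟦X⟧ :=
  PowerSeries.mk fun n => laurentDeriv (coeff n f)

theorem coeff_derivX (f : (LaurentSeries R)⟦X⟧) (n : ℕ) :
    coeff n (derivX f) = laurentDeriv (coeff n f) := by
  simp [derivX]

theorem isDeriv_derivX : IsDeriv (derivX (R := R)) where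
  map_add f g := by ext n : 1; simp [coeff_derivX, isDeriv_laurentDeriv.map_add]
  leibniz f g := by
    have hsum : ∀ (s : Finset (ℕ × ℕ)) (u : ℕ × ℕ → LaurentSeries R),
        laurentDeriv (∑ p ∈ s, u p) = ∑ p ∈ s, laurentDeriv (u p) := fun s u =>
      map_sum (AddMonoidHom.mk' laurentDeriv isDeriv_laurentDeriv.map_add) u s
    ext n : 1
    rw [mul_comm g, map_add, coeff_derivX]
    simp only [coeff_mul, hsum, coeff_derivX, isDeriv_laurentDeriv.leibniz,
      Finset.sum_add_distrib]
    congr 1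
    exact Finset.sum_congr rfl fun p _ => mul_comm _ _

/-- The coefficient of `x ^ m`, as a map `R((x))[[t]] → R[[t]]`. -/
noncomputable def xCoeff (m : ℤ) : (LaurentSeries R)⟦X⟧ →+ R⟦X⟧ where
  toFun f := PowerSeries.mk fun n => (coeff n f).coeff m
  map_zero' := by ext n; simp
  map_add' f g := by ext n; simp

theorem coeff_xCoeff (m : ℤ) (f : (LaurentSeries R)⟦X⟧) (n : ℕ) :
    coeff n (xCoeff m f) = (coeff n f).coeff m := by
  simp [xCoeff]

/-- The inclusion `R[[t]] → R((x))[[t]]`. -/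
noncomputable def constX : R⟦X⟧ →+* (LaurentSeries R)⟦X⟧ :=
  PowerSeries.map HahnSeries.C

theorem xCoeff_constX_mul (m : ℤ) (r : R⟦X⟧) (f : (LaurentSeries R)⟦X⟧) :
    xCoeff m (constX r * f) = r * xCoeff m f := by
  ext n
  simp only [coeff_xCoeff, constX, coeff_mul, coeff_map, HahnSeries.coeff_sum,
    HahnSeries.C_mul_eq_smul, HahnSeries.coeff_smul, smul_eq_mul]

theorem xCoeff_derivT (m : ℤ) (f : (LaurentSeries R)⟦X⟧) :
    xCoeff m (derivT f) = d⁄dX R (xCoeff m f) := by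
  ext n
  have h : ((n : LaurentSeries R) + 1) = HahnSeries.C ((n : R) + 1) := by
    rw [map_add, map_natCast, map_one]
  rw [coeff_xCoeff, PowerSeries.coeff_derivative, coeff_xCoeff, derivT,
    PowerSeries.coeff_derivative, h, mul_comm, HahnSeries.C_mul_eq_smul]
  simp [mul_comm]

theorem xCoeff_iterate_derivT (m : ℤ) (f : (LaurentSeries R)⟦X⟧) (k : ℕ) :
    xCoeff m (derivT^[k] f) = (d⁄dX R)^[k] (xCoeff m f) := by
  induction k generalizing f with
  | zero => rfl
  | succ k ih => rw [Function.iterate_succ_apply, ih, xCoeff_derivT, Function.iterate_succ_apply]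

theorem xCoeff_derivX (m : ℤ) (f : (LaurentSeries R)⟦X⟧) :
    xCoeff m (derivX f) = (m + 1 : ℤ) • xCoeff (m + 1) f := by
  ext n
  rw [coeff_xCoeff, coeff_derivX, coeff_laurentDeriv, map_zsmul, coeff_xCoeff]

theorem xCoeff_iterate_derivX (m : ℤ) (f : (LaurentSeries R)⟦X⟧) (k : ℕ) :
    xCoeff m (derivX^[k] f) = (∏ i ∈ Finset.range k, (m + 1 + i)) • xCoeff (m + k) f := by
  induction k generalizing f with
  | zero => simp
  | succ k ih =>
    rw [Function.iterate_succ_apply, ih, xCoeff_derivX, smul_smul, Finset.prod_range_succ]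
    push_cast
    ring_nf

theorem algebraMap_eq_constX (p : Polynomial R) :
    algebraMap (Polynomial R) (LaurentSeries R)⟦X⟧ p = constX (p : R⟦X⟧) := by
  ext n : 1
  rw [constX, coeff_map, Polynomial.coeff_coe, PowerSeries.algebraMap_apply', coeff_map,
    Polynomial.coeff_coe, HahnSeries.algebraMap_apply']
  simp

theorem derivT_constX (f : R⟦X⟧) : derivT (constX f) = constX (d⁄dX R f) := by
  ext n : 1
  rw [derivT, PowerSeries.coeff_derivative, constX, coeff_map, coeff_map,
    PowerSeries.coeff_derivative, map_mul, map_add, map_natCast, map_one]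

theorem derivX_constX (f : R⟦X⟧) : derivX (constX f) = 0 := by
  ext n m
  rw [coeff_derivX, coeff_laurentDeriv, constX, coeff_map, HahnSeries.C_apply]
  by_cases h : m + 1 = 0 <;> simp [h]

/-- The variable `x` of `R((x))[[t]]`. -/
noncomputable def xVar (R : Type*) [CommRing R] : (LaurentSeries R)⟦X⟧ :=
  PowerSeries.C (HahnSeries.single 1 1)

theorem derivT_xVar : derivT (xVar R) = 0 :=
  PowerSeries.derivative_C

theorem derivX_xVar : derivX (xVar R) = 1 := by
  ext n m
  rw [coeff_derivX, coeff_laurentDeriv, xVar, coeff_C, coeff_one]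
  split_ifs
  · by_cases h : m = 0 <;> simp [HahnSeries.coeff_one, h]
  · simp

/-- Lipshitz's argument: the coefficient of `x⁻¹` of a series whose mixed derivatives lie in a
finite-dimensional space over rational functions is D-finite. -/
theorem isDFinite_xCoeff [IsDomain R] [CharZero R] {ι : Type*} [Fintype ι]
    {ε : ι → (LaurentSeries R)⟦X⟧} {Q : (LaurentSeries R)⟦X⟧} {d : ℕ}
    (hT : CompatDerivation (Polynomial R) (xVar R) ε Q d derivT)
    (hX : CompatDerivation (Polynomial R) (xVar R) ε Q d derivX)
    (hQ0 : Q ≠ 0) (hQ : Q ∈ polyLE (Polynomial R) (xVar R) d) {F : (LaurentSeries R)⟦X⟧}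
    (hF : Q * F ∈ polySpan (Polynomial R) (xVar R) ε d) :
    IsDFinite (xCoeff (-1) F) := by
  obtain ⟨N, c, hc, hrel⟩ := exists_relation hX hT hQ0 hQ hF
  have hex : ∃ k : ℕ, ∃ hk : k < N, ∃ i : Fin N, c (⟨k, hk⟩, i) ≠ 0 := by
    obtain ⟨p, hp⟩ := Function.ne_iff.1 hc
    exact ⟨p.1, p.1.2, p.2, hp⟩
  classical
  obtain ⟨hk, i₀, hi₀⟩ := Nat.find_spec hex
  set k := Nat.find hex with hkdef
  have hmin : ∀ j : Fin N, (j : ℕ) < k → ∀ i, c (j, i) = 0 := fun j hj i => by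
    by_contra h
    exact Nat.find_min hex hj ⟨j.2, i, h⟩
  set u : ℤ := ∏ i ∈ Finset.range k, ((-1 - k : ℤ) + 1 + i) with hu
  have hu0 : u ≠ 0 := Finset.prod_ne_zero_iff.2 fun i hi => by
    have := Finset.mem_range.1 hi
    omega
  have hsum : ∑ i : Fin N, (((u • c (⟨k, hk⟩, i) : Polynomial R)) : R⟦X⟧) *
      (d⁄dX R)^[(i : ℕ)] (xCoeff (-1) F) = 0 := by
    have h := congrArg (xCoeff (-1 - k : ℤ)) hrel
    rw [map_sum, map_zero, Fintype.sum_prod_type, Finset.sum_eq_single ⟨k, hk⟩] at h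
    · rw [← h]
      refine Finset.sum_congr rfl fun i _ => ?_
      rw [Algebra.smul_def (R := Polynomial R) (A := (LaurentSeries R)⟦X⟧), algebraMap_eq_constX,
        xCoeff_constX_mul, xCoeff_iterate_derivX, ← hu, show (-1 - k : ℤ) + k = -1 by ring,
        xCoeff_iterate_derivT, ← Polynomial.coeToPowerSeries.ringHom_apply,
        ← Polynomial.coeToPowerSeries.ringHom_apply, map_zsmul, smul_mul_assoc, mul_smul_comm]
    · intro j _ hj
      refine Finset.sum_eq_zero fun i _ => ?_
      rcases lt_trichotomy (j : ℕ) k with hlt | heq | hgt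
      · rw [hmin j hlt i, Algebra.smul_def (R := Polynomial R) (A := (LaurentSeries R)⟦X⟧),
          map_zero, zero_mul, map_zero]
      · exact absurd (Fin.ext heq) hj
      · rw [Algebra.smul_def, algebraMap_eq_constX, xCoeff_constX_mul, xCoeff_iterate_derivX,
          Finset.prod_eq_zero (Finset.mem_range.2 hgt) (by ring), zero_smul, mul_zero]
    · simp
  obtain ⟨M, rfl⟩ : ∃ M, N = M + 1 := ⟨N - 1, by omega⟩
  exact ⟨M, fun i => u • c (⟨k, hk⟩, i), ⟨i₀, smul_ne_zero hu0 hi₀⟩, hsum⟩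

end LaurentPowerSeries

section RationalElements

variable {L : Type*} [CommRing L] [IsDomain L]

/-- The elements of `L` which are quotients of elements of the subring `A`. -/
def ratSubring (A : Subring L) : Subring L where
  carrier := {f | ∃ q ∈ A, q ≠ 0 ∧ q * f ∈ A}
  mul_mem' := by
    rintro f g ⟨q, hq, hq0, hf⟩ ⟨r, hr, hr0, hg⟩
    refine ⟨q * r, mul_mem hq hr, mul_ne_zero hq0 hr0, ?_⟩
    convert mul_mem hf hg using 1
    ring
  one_mem' := ⟨1, one_mem A, one_ne_zero, by simp⟩
  add_mem' := by
    rintro f g ⟨q, hq, hq0, hf⟩ ⟨r, hr, hr0, hg⟩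
    refine ⟨q * r, mul_mem hq hr, mul_ne_zero hq0 hr0, ?_⟩
    convert add_mem (mul_mem hr hf) (mul_mem hq hg) using 1
    ring
  zero_mem' := ⟨1, one_mem A, one_ne_zero, by simp⟩
  neg_mem' := by
    rintro f ⟨q, hq, hq0, hf⟩
    exact ⟨q, hq, hq0, by simpa using hf⟩

theorem le_ratSubring (A : Subring L) : A ≤ ratSubring A := fun f hf =>
  ⟨1, one_mem A, one_ne_zero, by simpa using hf⟩

theorem mem_ratSubring_of_mul {A : Subring L} {r f : L} (hr : r ∈ ratSubring A) (hr0 : r ≠ 0)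
    (h : r * f ∈ ratSubring A) : f ∈ ratSubring A := by
  obtain ⟨q, hq, hq0, hqr⟩ := hr
  obtain ⟨p, hp, hp0, hpf⟩ := h
  refine ⟨p * (q * r), mul_mem hp hqr, mul_ne_zero hp0 (mul_ne_zero hq0 hr0), ?_⟩
  convert mul_mem hq hpf using 1
  ring

theorem IsDeriv.map_ratSubring {A : Subring L} {D : L → L} (hD : IsDeriv D)
    (hA : ∀ f ∈ A, D f ∈ A) {f : L} (hf : f ∈ ratSubring A) : D f ∈ ratSubring A := by
  have hf' := hf
  obtain ⟨q, hq, hq0, hqf⟩ := hf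
  refine mem_ratSubring_of_mul (le_ratSubring A hq) hq0 ?_
  have h := hD.leibniz q f
  rw [← sub_eq_iff_eq_add] at h
  rw [← h]
  exact sub_mem (le_ratSubring A (hA _ hqf)) (mul_mem hf' (le_ratSubring A (hA _ hq)))

/-- `f` is a combination of `1` and `μ` with coefficients quotients of elements of `A`. -/
def RatCombination (A : Subring L) (μ f : L) : Prop :=
  ∃ q ∈ ratSubring A, q ≠ 0 ∧ ∃ p ∈ ratSubring A, ∃ r ∈ ratSubring A, q * f = p + r * μ

theorem RatCombination.exists_mem {A : Subring L} {μ f : L} (h : RatCombination A μ f) :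
    ∃ q ∈ A, q ≠ 0 ∧ ∃ p ∈ A, ∃ r ∈ A, q * f = p + r * μ := by
  obtain ⟨q, ⟨q', hq', hq0', hqq⟩, hq0, p, ⟨p', hp', hp0', hpp⟩, r, ⟨r', hr', hr0', hrr⟩, h⟩ := h
  refine ⟨p' * r' * (q' * q), mul_mem (mul_mem hp' hr') hqq,
    mul_ne_zero (mul_ne_zero hp0' hr0') (mul_ne_zero hq0' hq0), q' * r' * (p' * p),
    mul_mem (mul_mem hq' hr') hpp, q' * p' * (r' * r), mul_mem (mul_mem hq' hp') hrr, ?_⟩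
  linear_combination p' * r' * q' * h

end RationalElements

section QuadraticDFinite

variable {R : Type*} [CommRing R]

/-- The subring `R[t][x]` of `R((x))[[t]]`. -/
noncomputable def polySubring (R : Type*) [CommRing R] : Subring (LaurentSeries R)⟦X⟧ :=
  (Algebra.adjoin (Polynomial R) {xVar R}).toSubring

theorem xVar_mem : xVar R ∈ polySubring R :=
  Algebra.subset_adjoin rfl

theorem constX_mem (p : Polynomial R) : constX (p : R⟦X⟧) ∈ polySubring R := by
  rw [← algebraMap_eq_constX]
  exact Subalgebra.algebraMap_mem _ _

theorem exists_mem_polyLE {f : (LaurentSeries R)⟦X⟧} (hf : f ∈ polySubring R) :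
    ∃ d, f ∈ polyLE (Polynomial R) (xVar R) d := by
  have hone : (1 : (LaurentSeries R)⟦X⟧) ∈ polyLE (Polynomial R) (xVar R) 0 := by
    simpa using mem_polySpan_gen (K := Polynomial R) (x := xVar R)
      (ε := fun _ : Unit => (1 : (LaurentSeries R)⟦X⟧)) (d := 0) () le_rfl
  refine Algebra.adjoin_induction (p := fun f _ => ∃ d, f ∈ polyLE (Polynomial R) (xVar R) d)
    ?_ ?_ ?_ ?_ hf
  · rintro _ rfl
    refine ⟨1, ?_⟩
    simpa using mem_polySpan_gen (K := Polynomial R) (x := xVar R)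
      (ε := fun _ : Unit => (1 : (LaurentSeries R)⟦X⟧)) (d := 1) () le_rfl
  · intro r
    refine ⟨0, ?_⟩
    rw [Algebra.algebraMap_eq_smul_one]
    exact Submodule.smul_mem _ _ hone
  · rintro f g _ _ ⟨d, hf⟩ ⟨e, hg⟩
    exact ⟨d + e, add_mem (polySpan_mono (by omega) hf) (polySpan_mono (by omega) hg)⟩
  · rintro f g _ _ ⟨d, hf⟩ ⟨e, hg⟩
    exact ⟨d + e, mul_mem_polySpan hf hg⟩

theorem exists_derivT_const (p : Polynomial R) : ∃ p' : Polynomial R,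
    derivT (algebraMap (Polynomial R) (LaurentSeries R)⟦X⟧ p) = algebraMap _ _ p' :=
  ⟨p.derivative, by
    rw [algebraMap_eq_constX, algebraMap_eq_constX, derivT_constX, PowerSeries.derivative_coe]⟩

theorem exists_derivX_const (p : Polynomial R) : ∃ p' : Polynomial R,
    derivX (algebraMap (Polynomial R) (LaurentSeries R)⟦X⟧ p) = algebraMap _ _ p' :=
  ⟨0, by rw [algebraMap_eq_constX, derivX_constX, map_zero]⟩

theorem IsDeriv.map_polySubring {D : (LaurentSeries R)⟦X⟧ → (LaurentSeries R)⟦X⟧} (hD : IsDeriv D)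
    (hc : ∀ p : Polynomial R, ∃ p' : Polynomial R, D (algebraMap _ _ p) = algebraMap _ _ p')
    (hx : ∃ p' : Polynomial R, D (xVar R) = algebraMap _ _ p') :
    ∀ f ∈ polySubring R, D f ∈ polySubring R := by
  intro f hf
  refine Algebra.adjoin_induction (p := fun f _ => D f ∈ polySubring R) ?_ ?_ ?_ ?_ hf
  · rintro _ rfl
    obtain ⟨p, hp⟩ := hx
    rw [hp]
    exact Subalgebra.algebraMap_mem _ _
  · intro p
    obtain ⟨p', hp⟩ := hc p
    rw [hp]
    exact Subalgebra.algebraMap_mem _ _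
  · intro f g _ _ hf hg
    rw [hD.map_add]
    exact add_mem hf hg
  · intro f g hf' hg' hf hg
    rw [hD.leibniz]
    exact add_mem (mul_mem hf' hg) (mul_mem hg' hf)

theorem RatCombination.exists_mem_polySpan [IsDomain R] {μ f : (LaurentSeries R)⟦X⟧}
    (h : RatCombination (polySubring R) μ f) : ∃ q ∈ polySubring R, q ≠ 0 ∧
      ∃ d, q * f ∈ polySpan (Polynomial R) (xVar R) ![1, μ] d := by
  obtain ⟨q, hq, hq0, p, hp, r, hr, h⟩ := h.exists_mem
  obtain ⟨d, hp⟩ := exists_mem_polyLE hp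
  obtain ⟨e, hr⟩ := exists_mem_polyLE hr
  have hgen : ∀ k, ![1, μ] k ∈ polySpan (Polynomial R) (xVar R) ![1, μ] 0 := fun k => by
    simpa using mem_polySpan_gen (K := Polynomial R) (x := xVar R) (ε := ![1, μ]) (d := 0) k le_rfl
  refine ⟨q, hq, hq0, d + e, ?_⟩
  rw [h]
  have h1 := mul_mem_polySpan (hgen 0) hp
  have h2 := mul_mem_polySpan (hgen 1) hr
  simp only [Matrix.cons_val_zero, Matrix.cons_val_one, one_mul] at h1 h2
  rw [mul_comm r]
  exact add_mem (polySpan_mono (by omega) h1) (polySpan_mono (by omega) h2)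

/-- If the derivatives of `μ` and the series `F` are combinations of `1` and `μ` over `R(t, x)`,
then the coefficient of `x⁻¹` in `F` is D-finite. -/
theorem isDFinite_xCoeff_of_ratCombination [IsDomain R] [CharZero R] {μ F : (LaurentSeries R)⟦X⟧}
    (hT : RatCombination (polySubring R) μ (derivT μ))
    (hX : RatCombination (polySubring R) μ (derivX μ))
    (hF : RatCombination (polySubring R) μ F) : IsDFinite (xCoeff (-1) F) := by
  obtain ⟨q₁, hq₁, hq₁0, d₁, h₁⟩ := hT.exists_mem_polySpan
  obtain ⟨q₂, hq₂, hq₂0, d₂, h₂⟩ := hX.exists_mem_polySpan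
  obtain ⟨q₃, hq₃, hq₃0, d₃, h₃⟩ := hF.exists_mem_polySpan
  obtain ⟨e₁, he₁⟩ := exists_mem_polyLE hq₁
  obtain ⟨e₂, he₂⟩ := exists_mem_polyLE hq₂
  obtain ⟨e₃, he₃⟩ := exists_mem_polyLE hq₃
  set d := d₁ + d₂ + d₃ + (e₁ + e₂ + e₃)
  have hQ1 : q₁ * q₂ * q₃ * derivT μ ∈ polySpan (Polynomial R) (xVar R) ![1, μ] d := by
    convert polySpan_mono (e := d) (by omega) (mul_mem_polySpan (mul_mem_polySpan h₁ he₂) he₃)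
      using 1
    ring
  have hQ2 : q₁ * q₂ * q₃ * derivX μ ∈ polySpan (Polynomial R) (xVar R) ![1, μ] d := by
    convert polySpan_mono (e := d) (by omega) (mul_mem_polySpan (mul_mem_polySpan h₂ he₁) he₃)
      using 1
    ring
  have hQ3 : q₁ * q₂ * q₃ * F ∈ polySpan (Polynomial R) (xVar R) ![1, μ] d := by
    convert polySpan_mono (e := d) (by omega) (mul_mem_polySpan (mul_mem_polySpan h₃ he₁) he₂)
      using 1
    ring
  refine isDFinite_xCoeff (ε := ![1, μ]) (Q := q₁ * q₂ * q₃) (d := d)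
    ⟨isDeriv_derivT, exists_derivT_const, ⟨0, by rw [derivT_xVar, map_zero]⟩, ?_⟩
    ⟨isDeriv_derivX, exists_derivX_const, ⟨1, by rw [derivX_xVar, map_one]⟩, ?_⟩
    (mul_ne_zero (mul_ne_zero hq₁0 hq₂0) hq₃0)
    (polySpan_mono (by omega) (mul_mem_polySpan (mul_mem_polySpan he₁ he₂) he₃)) hQ3
  · intro k
    fin_cases k
    · simp [isDeriv_derivT.map_one]
    · simpa using hQ1
  · intro k
    fin_cases k
    · simp [isDeriv_derivX.map_one]
    · simpa using hQ2

end QuadraticDFinite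

section Quadratic

variable {L : Type*} [CommRing L] [IsDomain L]

theorem ratCombination_deriv_of_quadratic {A : Subring L} {D : L → L} (hD : IsDeriv D)
    (hA : ∀ f ∈ A, D f ∈ A) {c μ : L} (hc : c ∈ ratSubring A)
    (hc0 : c * ((1 - c) ^ 2 - 4 * c ^ 2) ≠ 0) (hμ : μ = c * (1 + μ + μ ^ 2)) :
    RatCombination A μ (D μ) := by
  have hDc := hD.map_ratSubring hA hc
  have h1 : D μ = c * (D μ + 2 * μ * D μ) + (1 + μ + μ ^ 2) * D c := by
    conv_lhs => rw [hμ, hD.leibniz, hD.map_add, hD.map_add, hD.map_one, hD.leibniz_pow]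
    push_cast
    ring
  have h2 : (2 : L) ∈ ratSubring A := by exact_mod_cast natCast_mem (ratSubring A) 2
  have h4 : (4 : L) ∈ ratSubring A := by exact_mod_cast natCast_mem (ratSubring A) 4
  have hone := one_mem (ratSubring A)
  refine ⟨_, mul_mem hc (sub_mem (pow_mem (sub_mem hone hc) 2) (mul_mem h4 (pow_mem hc 2))), hc0,
    D c * (2 * c), mul_mem hDc (mul_mem h2 hc), -(D c * (1 - c)),
    neg_mem (mul_mem hDc (sub_mem hone hc)), ?_⟩
  linear_combination c * (1 - c - 2 * c * μ) * h1 +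
    (4 * c ^ 2 * D μ + 2 * D c - D c * (1 - c - 2 * c * μ)) * hμ

theorem ratCombination_resolvent {A : Subring L} {c μ v V r s : L} (hc : c ∈ ratSubring A)
    (hv : v ∈ ratSubring A) (hr : r ∈ ratSubring A) (hs : s ∈ ratSubring A)
    (hW : (1 - v) * (1 - v * c) + c ^ 2 * v ^ 2 ≠ 0) (hμ : μ = c * (1 + μ + μ ^ 2))
    (hV : V * (1 - c * v * (1 + μ)) = 1) : RatCombination A μ (r + s * V) := by
  have hone := one_mem (ratSubring A)
  have hWm : (1 - v) * (1 - v * c) + c ^ 2 * v ^ 2 ∈ ratSubring A :=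
    add_mem (mul_mem (sub_mem hone hv) (sub_mem hone (mul_mem hv hc)))
      (mul_mem (pow_mem hc 2) (pow_mem hv 2))
  refine ⟨_, hWm, hW, _, add_mem (mul_mem hWm hr) (mul_mem hs (sub_mem hone hv)),
    s * (c * v), mul_mem hs (mul_mem hc hv), ?_⟩
  linear_combination s * (1 - v + c * v * μ) * hV - s * V * c * v ^ 2 * hμ

end Quadratic

section ProductModel

variable {R : Type*} [CommRing R]

theorem exists_eq_mul_one_add_add_sq {P : Type*} [CommRing P] {c : P⟦X⟧}
    (hc : constantCoeff c = 0) : ∃ μ : P⟦X⟧, μ = c * (1 + μ + μ ^ 2) := by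
  have hI : c ∈ Ideal.span {(X : P⟦X⟧)} := Ideal.mem_span_singleton.2 (X_dvd_iff.2 hc)
  have hunit : ∀ w ∈ Ideal.span {(X : P⟦X⟧)}, IsUnit (1 - c - w) := fun w hw => by
    rw [isUnit_iff_constantCoeff, map_sub, map_sub, hc,
      X_dvd_iff.1 (Ideal.mem_span_singleton.1 hw)]
    simp
  obtain ⟨w, hw, hw0⟩ := HenselianRing.is_henselian (I := Ideal.span {(X : P⟦X⟧)})
    (Polynomial.X ^ 2 + (Polynomial.C (c - 1) * Polynomial.X + Polynomial.C (c ^ 2)))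
    (Polynomial.monic_X_pow_add (Polynomial.degree_linear_lt.trans_le le_rfl)) 0
    (by simpa using Ideal.pow_mem_of_mem _ hI 2 two_pos)
    (by simpa [Polynomial.derivative_pow] using (hunit 0 (zero_mem _)).neg.map
          (Ideal.Quotient.mk (Ideal.span {(X : P⟦X⟧)})))
  rw [sub_zero] at hw0
  obtain ⟨u, hu⟩ := (hunit w hw0)
  have hui : (u : P⟦X⟧) * ↑u⁻¹ = 1 := u.mul_inv
  have hw' : w ^ 2 + (c - 1) * w + c ^ 2 = 0 := by
    simpa [Polynomial.IsRoot, ← add_assoc] using hw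
  refine ⟨c * ↑u⁻¹, ?_⟩
  generalize (↑u⁻¹ : P⟦X⟧) = q at *
  rw [hu] at hui
  linear_combination c * (1 - w * q) * hui - c * q ^ 2 * hw'

/-- The Laurent polynomial `x + 1 + x⁻¹`. -/
noncomputable def stepLaurent (R : Type*) [CommRing R] : LaurentSeries R :=
  HahnSeries.single 1 1 + 1 + HahnSeries.single (-1) 1

/-- The substitution of `x + 1 + x⁻¹` in power series with polynomial coefficients. -/
noncomputable def substStep : (Polynomial R)⟦X⟧ →+* (LaurentSeries R)⟦X⟧ :=
  PowerSeries.map (Polynomial.eval₂RingHom HahnSeries.C (stepLaurent R))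

theorem coeff_single_one_mul (f : LaurentSeries R) (m : ℤ) :
    (HahnSeries.single (1 : ℤ) (1 : R) * f).coeff m = f.coeff (m - 1) := by
  have h := HahnSeries.coeff_single_mul_add (r := (1 : R)) (x := f) (a := m - 1) (b := 1)
  rwa [sub_add_cancel, one_mul] at h

theorem coeff_single_neg_one_mul (f : LaurentSeries R) (m : ℤ) :
    (HahnSeries.single (-1 : ℤ) (1 : R) * f).coeff m = f.coeff (m + 1) := by
  have h := HahnSeries.coeff_single_mul_add (r := (1 : R)) (x := f) (a := m + 1) (b := -1)
  rwa [add_neg_cancel_right, one_mul] at h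

theorem coeff_eval₂_stepLaurent_neg (p : Polynomial R) (m : ℤ) :
    (p.eval₂ HahnSeries.C (stepLaurent R)).coeff (-m) =
      (p.eval₂ HahnSeries.C (stepLaurent R)).coeff m := by
  induction p using Polynomial.induction_on generalizing m with
  | C r =>
    rw [Polynomial.eval₂_C, HahnSeries.C_apply, HahnSeries.coeff_single, HahnSeries.coeff_single]
    simp
  | add p q hp hq => simp only [Polynomial.eval₂_add, HahnSeries.coeff_add, hp, hq]
  | monomial n r ih =>
    rw [pow_succ, ← mul_assoc, Polynomial.eval₂_mul_X, mul_comm, stepLaurent, add_mul, add_mul,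
      one_mul]
    simp only [HahnSeries.coeff_add, coeff_single_one_mul, coeff_single_neg_one_mul]
    rw [← stepLaurent, ← ih (-m - 1), ← ih (-m + 1), ← ih m]
    ring_nf

theorem xCoeff_neg_substStep (f : (Polynomial R)⟦X⟧) (m : ℤ) :
    xCoeff (-m) (substStep f) = xCoeff m (substStep f) := by
  ext n
  rw [coeff_xCoeff, coeff_xCoeff, substStep, coeff_map]
  exact coeff_eval₂_stepLaurent_neg _ m

/-- The series `x⁻¹`. -/
noncomputable def xInv (R : Type*) [CommRing R] : (LaurentSeries R)⟦X⟧ :=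
  PowerSeries.C (HahnSeries.single (-1) 1)

theorem xVar_mul_xInv : xVar R * xInv R = 1 := by
  rw [xVar, xInv, ← map_mul, HahnSeries.single_mul_single]
  simp

theorem xCoeff_xVar_mul (f : (LaurentSeries R)⟦X⟧) (m : ℤ) :
    xCoeff m (xVar R * f) = xCoeff (m - 1) f := by
  ext n
  rw [coeff_xCoeff, coeff_xCoeff, xVar, coeff_C_mul, coeff_single_one_mul]

theorem xCoeff_xInv_mul (f : (LaurentSeries R)⟦X⟧) (m : ℤ) :
    xCoeff m (xInv R * f) = xCoeff (m + 1) f := by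
  ext n
  rw [coeff_xCoeff, coeff_xCoeff, xInv, coeff_C_mul, coeff_single_neg_one_mul]

theorem C_stepLaurent : PowerSeries.C (stepLaurent R) = xVar R + 1 + xInv R := by
  simp only [stepLaurent, xVar, xInv, map_add, map_one]

/-- The inclusion `R[[x]][[t]] → R((x))[[t]]`. -/
noncomputable def ofPowerSeriesX : (R⟦X⟧)⟦X⟧ →+* (LaurentSeries R)⟦X⟧ :=
  PowerSeries.map (HahnSeries.ofPowerSeries ℤ R)

theorem xCoeff_zero_ofPowerSeriesX (f : (R⟦X⟧)⟦X⟧) :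
    xCoeff 0 (ofPowerSeriesX f) = PowerSeries.map constantCoeff f := by
  ext n
  rw [coeff_xCoeff, ofPowerSeriesX, coeff_map, coeff_map]
  simpa using HahnSeries.ofPowerSeries_apply_coeff (Γ := ℤ) (coeff n f) 0

theorem ofPowerSeriesX_C_X : ofPowerSeriesX (PowerSeries.C (X : R⟦X⟧)) = xVar R := by
  rw [ofPowerSeriesX, PowerSeries.map_C, HahnSeries.ofPowerSeries_X, xVar]

theorem ofPowerSeriesX_map_C (f : R⟦X⟧) :
    ofPowerSeriesX (PowerSeries.map PowerSeries.C f) = constX f := by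
  ext n : 1
  simp only [ofPowerSeriesX, constX, coeff_map, HahnSeries.ofPowerSeries_C]

/-- The vertical factor: a family `V` with `V 0` a resolvent of the root `μ` of a quadratic
equation, satisfying the recurrence of a half-line model with boundary weight `v`. -/
theorem exists_vertical_factor {P : Type*} [CommRing P] {c : P⟦X⟧} (hc : constantCoeff c = 0)
    (v : P⟦X⟧) : ∃ (μ : P⟦X⟧) (V : ℕ → P⟦X⟧), μ = c * (1 + μ + μ ^ 2) ∧
      V 0 * (1 - c * v * (1 + μ)) = 1 ∧
      ∀ j, V j = (if j = 0 then 1 else 0) +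
        c * (if j = 0 then v else 1) * ∑ l ∈ Finset.Icc (j - 1) (j + 1), V l := by
  obtain ⟨μ, hμ⟩ := exists_eq_mul_one_add_add_sq hc
  obtain ⟨w, hw⟩ : IsUnit (1 - c * v * (1 + μ)) := by
    rw [isUnit_iff_constantCoeff, map_sub, map_mul, map_mul, hc]
    simp
  have hV : ↑w⁻¹ * (1 - c * v * (1 + μ)) = 1 := by rw [← hw, Units.inv_mul]
  refine ⟨μ, fun j => μ ^ j * ↑w⁻¹, hμ, by simpa only [pow_zero, one_mul] using hV, fun j => ?_⟩
  generalize (↑w⁻¹ : P⟦X⟧) = V₀ at hV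
  rcases j with _ | j
  · rw [show Finset.Icc (0 - 1) (0 + 1) = {0, 1} from rfl, Finset.sum_pair zero_ne_one]
    simp only [if_true, pow_zero, pow_one]
    linear_combination hV
  · rw [show Finset.Icc (j + 1 - 1) (j + 1 + 1) = {j, j + 1, j + 2} by ext; simp; omega,
      Finset.sum_insert (by simp), Finset.sum_pair (by simp)]
    simp only [Nat.add_eq_zero_iff, one_ne_zero, and_false, if_false]
    linear_combination μ ^ j * V₀ * hμ

/-- The horizontal factor: `C i = x ^ i * C 0` satisfies the adjoint recurrence, up to a multiple
of `x⁻¹ - x`, and the constant term of `C i` is the Kronecker delta. -/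
theorem exists_horizontal_factor (v : R⟦X⟧) : ∃ C : ℕ → (LaurentSeries R)⟦X⟧,
    C 0 * (1 + xVar R + xVar R ^ 2 - constX v * (xVar R * (1 + xVar R))) = 1 - xVar R ^ 2 ∧
    (∀ i, xCoeff 0 (C i) = if i = 0 then 1 else 0) ∧
    ∀ i, (xVar R + 1 + xInv R) * C i = (if i = 0 then xInv R - xVar R else 0) +
      constX (if i = 0 then v else 1) * ∑ k ∈ Finset.Icc (i - 1) (i + 1), C k := by
  set y : (R⟦X⟧)⟦X⟧ := PowerSeries.C X with hy
  have hy0 : PowerSeries.map constantCoeff y = 0 := by simp [hy]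
  obtain ⟨w, hw⟩ : IsUnit (1 + y + y ^ 2 - PowerSeries.map PowerSeries.C v * (y * (1 + y))) := by
    rw [isUnit_iff_constantCoeff, isUnit_iff_constantCoeff]
    simp [hy]
  set C₀ := (1 - y ^ 2) * ↑w⁻¹
  have hC₀ : C₀ * (1 + y + y ^ 2 - PowerSeries.map PowerSeries.C v * (y * (1 + y))) =
      1 - y ^ 2 := by
    rw [← hw, mul_assoc, Units.inv_mul, mul_one]
  have hC := congrArg ofPowerSeriesX hC₀
  simp only [map_mul, map_add, map_sub, map_pow, map_one, ofPowerSeriesX_map_C, hy,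
    ofPowerSeriesX_C_X] at hC
  have hx := xVar_mul_xInv (R := R)
  refine ⟨fun i => xVar R ^ i * ofPowerSeriesX C₀, by simpa only [pow_zero, one_mul] using hC,
    fun i => ?_, fun i => ?_⟩
  · beta_reduce
    rw [← ofPowerSeriesX_C_X, ← map_pow, ← map_mul, xCoeff_zero_ofPowerSeriesX, ← hy, map_mul,
      map_pow, hy0]
    have h := congrArg (PowerSeries.map constantCoeff) hC₀
    simp only [map_mul, map_add, map_sub, map_pow, map_one, hy0] at h
    rcases i with _ | i
    · simpa using h
    · simp
  · generalize ofPowerSeriesX C₀ = E at hC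
    rcases i with _ | i
    · rw [show Finset.Icc (0 - 1) (0 + 1) = {0, 1} from rfl, Finset.sum_pair zero_ne_one]
      simp only [if_true, pow_zero, pow_one]
      linear_combination xInv R * hC + (-E - E * xVar R + constX v * (1 + xVar R) * E - xVar R) * hx
    · rw [show Finset.Icc (i + 1 - 1) (i + 1 + 1) = {i, i + 1, i + 2} by ext; simp; omega,
        Finset.sum_insert (by simp), Finset.sum_pair (by simp)]
      simp only [Nat.add_eq_zero_iff, one_ne_zero, and_false, if_false, map_one]
      linear_combination xVar R ^ i * E * hx

/-- The solution of the product model, with the generating function of excursions as the constant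
term of an explicit algebraic series. -/
theorem exists_product_model {z : R⟦X⟧} (hz : constantCoeff z = 0) (va vb : R⟦X⟧) :
    ∃ (c μ V C : (LaurentSeries R)⟦X⟧) (e : ℕ → ℕ → R⟦X⟧),
      c = constX z * (xVar R + 1 + xInv R) ∧ μ = c * (1 + μ + μ ^ 2) ∧
      V * (1 - c * constX va * (1 + μ)) = 1 ∧
      C * (1 + xVar R + xVar R ^ 2 - constX vb * (xVar R * (1 + xVar R))) = 1 - xVar R ^ 2 ∧
      e 0 0 = xCoeff 0 (C * V) ∧
      ∀ i j, e i j = (if i = 0 ∧ j = 0 then 1 else 0) +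
        z * (if j = 0 then va else 1) * (if i = 0 then vb else 1) *
          ∑ k ∈ Finset.Icc (i - 1) (i + 1), ∑ l ∈ Finset.Icc (j - 1) (j + 1), e k l := by
  obtain ⟨μ, V, hμ, hV, hVrec⟩ := exists_vertical_factor
    (c := PowerSeries.map Polynomial.C z * PowerSeries.C Polynomial.X)
    (by rw [map_mul, ← coeff_zero_eq_constantCoeff_apply, coeff_map,
      coeff_zero_eq_constantCoeff_apply, hz]; simp) (PowerSeries.map Polynomial.C va)
  obtain ⟨C, hC, hC0, hCrec⟩ := exists_horizontal_factor vb
  have hsub : ∀ f : R⟦X⟧, substStep (PowerSeries.map Polynomial.C f) = constX f := fun f => by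
    ext n : 1
    rw [substStep, constX, coeff_map, coeff_map, coeff_map, Polynomial.coe_eval₂RingHom,
      Polynomial.eval₂_C]
  have hsubX : substStep (PowerSeries.C (Polynomial.X : Polynomial R)) =
      xVar R + 1 + xInv R := by
    rw [← C_stepLaurent, substStep, PowerSeries.map_C, Polynomial.coe_eval₂RingHom,
      Polynomial.eval₂_X]
  have hμ' := congrArg substStep hμ
  have hV' := congrArg substStep hV
  have hVrec' := fun j => congrArg substStep (hVrec j)
  simp only [map_mul, map_add, map_sub, map_pow, map_one, hsub, hsubX] at hμ' hV'
  refine ⟨_, substStep μ, substStep (V 0), C 0, fun i j => xCoeff 0 (C i * substStep (V j)), rfl,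
    hμ', hV', hC, rfl, fun i j => ?_⟩
  have hanti : ∀ l, xCoeff 0 ((xInv R - xVar R) * substStep (V l)) = 0 := fun l => by
    rw [sub_mul, map_sub, xCoeff_xInv_mul, xCoeff_xVar_mul, zero_sub, xCoeff_neg_substStep,
      zero_add, sub_self]
  have hVj : substStep (V j) = (if j = 0 then 1 else 0) +
      constX z * (xVar R + 1 + xInv R) * constX (if j = 0 then va else 1) *
        ∑ l ∈ Finset.Icc (j - 1) (j + 1), substStep (V l) := by
    rw [hVrec' j, map_add, map_mul, map_mul, map_mul, hsub, hsubX, map_sum]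
    split_ifs <;> simp [hsub]
  have h1 : C i * substStep (V j) = (if j = 0 then C i else 0) +
      constX (z * (if j = 0 then va else 1)) * ∑ l ∈ Finset.Icc (j - 1) (j + 1),
        ((if i = 0 then (xInv R - xVar R) * substStep (V l) else 0) +
        constX (if i = 0 then vb else 1) *
          ∑ k ∈ Finset.Icc (i - 1) (i + 1), C k * substStep (V l)) := by
    have h2 : ∀ l, (if i = 0 then (xInv R - xVar R) * substStep (V l) else 0) +
        constX (if i = 0 then vb else 1) *
          ∑ k ∈ Finset.Icc (i - 1) (i + 1), C k * substStep (V l) =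
        (xVar R + 1 + xInv R) * C i * substStep (V l) := fun l => by
      rw [hCrec i, add_mul, mul_assoc, Finset.sum_mul, ite_mul, zero_mul]
    simp only [h2]
    rw [hVj, ← Finset.mul_sum, map_mul]
    split_ifs <;> ring
  have h3 : ∀ l, xCoeff 0 (if i = 0 then (xInv R - xVar R) * substStep (V l) else 0) = 0 :=
    fun l => by split_ifs <;> simp [hanti]
  beta_reduce
  rw [h1, map_add, xCoeff_constX_mul, map_sum]
  simp only [map_add, xCoeff_constX_mul, h3, zero_add, map_sum, ← Finset.mul_sum]
  rw [Finset.sum_comm, apply_ite (xCoeff 0), hC0, map_zero]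
  congr 1
  · by_cases hi : i = 0 <;> by_cases hj : j = 0 <;> simp [hi, hj]
  · ring

end ProductModel

section ProductModelDFinite

variable {R : Type*} [CommRing R]

theorem constX_injective : Function.Injective (constX (R := R)) :=
  PowerSeries.map_injective _ HahnSeries.C_injective

variable [IsDomain R]

theorem xInv_mem : xInv R ∈ ratSubring (polySubring R) := by
  have h := xVar_mul_xInv (R := R)
  refine mem_ratSubring_of_mul (le_ratSubring _ xVar_mem) (fun h0 => ?_) (h ▸ one_mem _)
  rw [h0, zero_mul] at h
  exact zero_ne_one h

theorem constX_mem_ratSubring (p : Polynomial R) :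
    constX (p : R⟦X⟧) ∈ ratSubring (polySubring R) :=
  le_ratSubring _ (constX_mem p)

theorem constX_mem_of_mul_eq_one {f : R⟦X⟧} (p : Polynomial R) (h : f * p = 1) :
    constX f ∈ ratSubring (polySubring R) := by
  refine mem_ratSubring_of_mul (constX_mem_ratSubring p) (fun h0 => ?_) ?_
  · rw [map_eq_zero_iff _ constX_injective] at h0
    rw [h0, mul_zero] at h
    exact zero_ne_one h
  · rw [← map_mul, mul_comm, h, map_one]
    exact one_mem _

/-- The product model attached to king walks with boundary weights `a` and `b`: its excursion
series `e 0 0` is D-finite, and so are its rational affine images. -/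
theorem exists_dfinite_product_model [CharZero R] (a b : R) {s sa sb : R⟦X⟧}
    (hs : s * (1 + X) = 1) (hsa : sa * (1 + C a * X) = 1) (hsb : sb * (1 + C b * X) = 1) :
    ∃ e : ℕ → ℕ → R⟦X⟧,
      (∀ i j, e i j = (if i = 0 ∧ j = 0 then 1 else 0) +
        X * s * (if j = 0 then C a * (1 + X) * sa else 1) *
          (if i = 0 then C b * (1 + X) * sb else 1) *
          ∑ k ∈ Finset.Icc (i - 1) (i + 1), ∑ l ∈ Finset.Icc (j - 1) (j + 1), e k l) ∧
      ∀ f g : R⟦X⟧, constX f ∈ ratSubring (polySubring R) →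
        constX g ∈ ratSubring (polySubring R) → IsDFinite (f + g * e 0 0) := by
  obtain ⟨c, μ, V, U, e, hc, hμ, hV, hU, he, hrec⟩ :=
    exists_product_model (z := X * s) (by simp) (C a * (1 + X) * sa) (C b * (1 + X) * sb)
  refine ⟨e, hrec, fun f g hf hg => ?_⟩
  set A := ratSubring (polySubring R)
  have hone : (1 : (LaurentSeries R)⟦X⟧) ∈ A := one_mem A
  have hx : xVar R ∈ A := le_ratSubring _ xVar_mem
  have hXm : constX (X : R⟦X⟧) ∈ A := by
    simpa using constX_mem_ratSubring (Polynomial.X : Polynomial R)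
  have hCm : ∀ r : R, constX (C r : R⟦X⟧) ∈ A := fun r => by
    simpa using constX_mem_ratSubring (Polynomial.C r : Polynomial R)
  have hsm : constX s ∈ A :=
    constX_mem_of_mul_eq_one (1 + Polynomial.X) (by simpa using hs)
  have hsm' : ∀ {r : R} {q : R⟦X⟧}, q * (1 + C r * X) = 1 →
      constX (C r * (1 + X) * q) ∈ A := fun {r q} h => by
    rw [map_mul, map_mul, map_add, map_one]
    exact mul_mem (mul_mem (hCm r) (add_mem hone hXm))
      (constX_mem_of_mul_eq_one (1 + Polynomial.C r * Polynomial.X) (by simpa using h))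
  have hcm : c ∈ A := by
    rw [hc, map_mul]
    exact mul_mem (mul_mem hXm hsm) (add_mem (add_mem hx hone) xInv_mem)
  have hx2 : (1 : (LaurentSeries R)⟦X⟧) - xVar R ^ 2 ≠ 0 := fun h => by
    have h' := congrArg (fun f => (constantCoeff f).coeff 0) h
    simp [xVar] at h'
  have hUm : U ∈ A := by
    refine mem_ratSubring_of_mul (r := 1 + xVar R + xVar R ^ 2 -
      constX (C b * (1 + X) * sb) * (xVar R * (1 + xVar R)))
      (sub_mem (add_mem (add_mem hone hx) (pow_mem hx 2))
        (mul_mem (hsm' hsb) (mul_mem hx (add_mem hone hx))))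
      (fun h0 => hx2 (by rw [← hU, h0, mul_zero])) ?_
    rw [mul_comm, hU]
    exact sub_mem hone (pow_mem hx 2)
  have hcc : constantCoeff c = 0 := by simp [hc, constX]
  have hc0 : c ≠ 0 := fun h0 => by
    have h1 : X * (xVar R + 1 + xInv R) = 0 := by
      have h2 := congrArg (· * constX (1 + X)) h0
      have h3 := congrArg constX hs
      simp only [hc, map_mul, zero_mul, map_one] at h2 h3
      rw [← h2, show (X : (LaurentSeries R)⟦X⟧) = constX X by simp [constX]]
      linear_combination -constX X * (xVar R + 1 + xInv R) * h3
    have h4 := congrArg (fun f => (coeff 1 f).coeff 0) h1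
    rw [← C_stepLaurent] at h4
    simp [coeff_succ_X_mul, stepLaurent] at h4
  have hdisc : c * ((1 - c) ^ 2 - 4 * c ^ 2) ≠ 0 := by
    refine mul_ne_zero hc0 fun h => ?_
    have h' := congrArg constantCoeff h
    simp [hcc] at h'
  have hW : (1 - constX (C a * (1 + X) * sa)) * (1 - constX (C a * (1 + X) * sa) * c) +
      c ^ 2 * constX (C a * (1 + X) * sa) ^ 2 ≠ 0 := by
    by_cases ha : a = 1
    · have h1 : C a * (1 + X) * sa = 1 := by
        rw [ha, map_one, one_mul] at hsa
        rw [ha, map_one, one_mul, mul_comm, hsa]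
      rw [h1, map_one]
      simpa using hc0
    · intro h
      have h1 : constantCoeff sa = 1 := by simpa using congrArg constantCoeff hsa
      have h2 : constantCoeff (constX (C a * (1 + X) * sa)) = HahnSeries.C a := by
        rw [constX, ← coeff_zero_eq_constantCoeff_apply, coeff_map,
          coeff_zero_eq_constantCoeff_apply]
        simp [h1]
      generalize constX (C a * (1 + X) * sa) = v at h h2
      have h' := congrArg constantCoeff h
      simp only [map_add, map_mul, map_sub, map_one, map_pow, map_zero, hcc, h2] at h'
      have h3 : HahnSeries.C (1 - a) = (0 : LaurentSeries R) := by
        rw [map_sub, map_one]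
        linear_combination h'
      rw [map_eq_zero_iff _ HahnSeries.C_injective] at h3
      exact ha (sub_eq_zero.1 h3).symm
  have hF := ratCombination_resolvent hcm (hsm' hsa)
    (mul_mem xInv_mem hf) (mul_mem (mul_mem xInv_mem hg) hUm) hW hμ hV
  have hres := isDFinite_xCoeff_of_ratCombination
    (ratCombination_deriv_of_quadratic isDeriv_derivT (isDeriv_derivT.map_polySubring
      exists_derivT_const ⟨0, by rw [derivT_xVar, map_zero]⟩) hcm hdisc hμ)
    (ratCombination_deriv_of_quadratic isDeriv_derivX (isDeriv_derivX.map_polySubring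
      exists_derivX_const ⟨1, by rw [derivX_xVar, map_one]⟩) hcm hdisc hμ) hF
  have hxC : xCoeff 0 (1 : (LaurentSeries R)⟦X⟧) = 1 := by
    ext n
    rw [coeff_xCoeff, coeff_one, coeff_one]
    split_ifs <;> simp
  have hval : xCoeff (-1) (xInv R * constX f + xInv R * constX g * U * V) = f + g * e 0 0 := by
    rw [show xInv R * constX f + xInv R * constX g * U * V =
      xInv R * (constX f * 1 + constX g * (U * V)) by ring, xCoeff_xInv_mul, neg_add_cancel,
      map_add, xCoeff_constX_mul, xCoeff_constX_mul, hxC, mul_one, he]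
  rwa [hval] at hres

end ProductModelDFinite

section KingWalks

/-- The set of the eight short steps. -/
abbrev kingSteps : Set (ℤ × ℤ) :=
  {((1:ℤ), (0:ℤ)), (-1, 0), (0, 1), (0, -1), (1, 1), (1, -1), (-1, 1), (-1, -1)}

/-- The points of the quadrant from which `p` can be reached by one king step. -/
def kingNbrs (p : ℕ × ℕ) : Finset (ℕ × ℕ) :=
  (Finset.Icc (p.1 - 1) (p.1 + 1) ×ˢ Finset.Icc (p.2 - 1) (p.2 + 1)).erase p

theorem mem_kingNbrs {p q : ℕ × ℕ} :
    q ∈ kingNbrs p ↔ ((p.1 : ℤ) - q.1, (p.2 : ℤ) - q.2) ∈ kingSteps := by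
  obtain ⟨i, j⟩ := p
  obtain ⟨k, l⟩ := q
  simp only [kingNbrs, Finset.mem_erase, Finset.mem_product, Finset.mem_Icc, kingSteps,
    Set.mem_insert_iff, Set.mem_singleton_iff, Prod.mk.injEq, ne_eq]
  omega

variable {R : Type*} [CommRing R]

/-- The weight of a visit at the point `p`. -/
def visitWeight (a b : R) (p : ℕ × ℕ) : R :=
  (if p.2 = 0 then a else 1) * (if p.1 = 0 then b else 1)

/-- The weighted number of king walks of length `n` in the quadrant from the origin to `p`. -/
def kingCount (a b : R) : ℕ → ℕ × ℕ → R
  | 0, p => if p = (0, 0) then 1 else 0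
  | n + 1, p => visitWeight a b p * ∑ q ∈ kingNbrs p, kingCount a b n q

theorem hvisits_snoc {n : ℕ} (w : Fin (n + 1) → ℕ × ℕ) (p : ℕ × ℕ) :
    hvisits (Fin.snoc w p : Fin (n + 2) → ℕ × ℕ) = hvisits w + if p.2 = 0 then 1 else 0 := by
  rw [hvisits, hvisits, Finset.card_filter, Finset.card_filter, Fin.sum_univ_castSucc]
  simp only [Fin.snoc_castSucc, Fin.snoc_last, Fin.val_castSucc, Fin.val_last, Nat.succ_pos,
    true_and]

theorem vvisits_snoc {n : ℕ} (w : Fin (n + 1) → ℕ × ℕ) (p : ℕ × ℕ) :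
    vvisits (Fin.snoc w p : Fin (n + 2) → ℕ × ℕ) = vvisits w + if p.1 = 0 then 1 else 0 := by
  rw [vvisits, vvisits, Finset.card_filter, Finset.card_filter, Fin.sum_univ_castSucc]
  simp only [Fin.snoc_castSucc, Fin.snoc_last, Fin.val_castSucc, Fin.val_last, Nat.succ_pos,
    true_and]

theorem exists_finset_kingWalks (a b : R) (n : ℕ) (p : ℕ × ℕ) :
    ∃ T : Finset (Fin (n + 1) → ℕ × ℕ),
      (∀ w, w ∈ T ↔ w 0 = (0, 0) ∧ w (Fin.last n) = p ∧
        ∀ i : Fin n, w i.castSucc ∈ kingNbrs (w i.succ)) ∧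
      ∑ w ∈ T, a ^ hvisits w * b ^ vvisits w = kingCount a b n p := by
  classical
  induction n generalizing p with
  | zero =>
    by_cases hp : p = (0, 0)
    · refine ⟨{fun _ => (0, 0)}, fun w => ?_, by simp [kingCount, hp, hvisits, vvisits]⟩
      rw [Finset.mem_singleton, hp]
      constructor
      · rintro rfl
        simp
      · rintro ⟨h, -, -⟩
        ext1 i
        rw [Fin.fin_one_eq_zero i, ← h]
    · refine ⟨∅, fun w => ?_, by simp [kingCount, hp]⟩
      simp only [Finset.notMem_empty, false_iff]
      rintro ⟨h, h', -⟩
      exact hp (h'.symm.trans h)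
  | succ n ih =>
    choose T hT hsum using ih
    have hinj : Function.Injective
        fun w : Fin (n + 1) → ℕ × ℕ => (Fin.snoc w p : Fin (n + 2) → ℕ × ℕ) := fun w w' h => by
      simpa using congrArg (Fin.init (α := fun _ => ℕ × ℕ)) h
    refine ⟨((kingNbrs p).biUnion T).image fun w => Fin.snoc w p, fun w => ?_, ?_⟩
    · simp only [Finset.mem_image, Finset.mem_biUnion, hT]
      constructor
      · rintro ⟨w, ⟨q, hq, h0, hl, hs⟩, rfl⟩
        refine ⟨by rw [← Fin.castSucc_zero, Fin.snoc_castSucc, h0], Fin.snoc_last _ _, fun i => ?_⟩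
        induction i using Fin.lastCases with
        | last => rwa [Fin.snoc_castSucc, Fin.succ_last, Fin.snoc_last, hl]
        | cast i => rw [Fin.snoc_castSucc, ← Fin.castSucc_succ, Fin.snoc_castSucc]; exact hs i
      · rintro ⟨h0, hl, hs⟩
        refine ⟨Fin.init w, ⟨w (Fin.last n).castSucc, ?_, h0, rfl, fun i => hs i.castSucc⟩, ?_⟩
        · rw [← hl]
          exact hs (Fin.last n)
        · rw [← hl]
          exact Fin.snoc_init_self w
    · rw [Finset.sum_image hinj.injOn, Finset.sum_biUnion, kingCount, Finset.mul_sum]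
      · refine Finset.sum_congr rfl fun q _ => ?_
        rw [← hsum, Finset.mul_sum]
        refine Finset.sum_congr rfl fun w _ => ?_
        rw [hvisits_snoc, vvisits_snoc, visitWeight]
        split_ifs <;> ring
      · intro q _ q' _ hne
        refine Finset.disjoint_left.2 fun w hw hw' => hne ?_
        rw [← ((hT q w).1 hw).2.1, ((hT q' w).1 hw').2.1]

theorem coeff_loopGF_kingSteps (a b : R) (n : ℕ) :
    coeff n (loopGF kingSteps a b) = kingCount a b n (0, 0) := by
  obtain ⟨T, hT, hsum⟩ := exists_finset_kingWalks a b n (0, 0)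
  have h : {w : Fin (n + 1) → ℕ × ℕ | IsQPLoop kingSteps n w} = T := by
    ext w
    simp only [Set.mem_ofPred_eq, SetLike.mem_coe, hT, IsQPLoop, mem_kingNbrs]
  rw [loopGF, coeff_mk, ← hsum, ← finsum_mem_coe_finset, ← h]
  exact finsum_set_coe_eq_finsum_mem (f := fun w => a ^ hvisits w * b ^ vvisits w)
    {w : Fin (n + 1) → ℕ × ℕ | IsQPLoop kingSteps n w}

/-- The generating function of king walks in the quadrant from the origin to `p`. -/
def kingGF (a b : R) (p : ℕ × ℕ) : R⟦X⟧ :=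
  PowerSeries.mk fun n => kingCount a b n p

theorem kingGF_eq (a b : R) (p : ℕ × ℕ) : kingGF a b p = (if p = (0, 0) then 1 else 0) +
    X * (C (visitWeight a b p) * ∑ q ∈ kingNbrs p, kingGF a b q) := by
  ext n
  rcases n with _ | n
  · rw [kingGF, coeff_mk, kingCount, map_add, coeff_zero_X_mul, add_zero]
    split_ifs <;> simp
  · rw [map_add, coeff_succ_X_mul, coeff_C_mul, kingGF, coeff_mk, kingCount, map_sum]
    simp only [kingGF, coeff_mk]
    split_ifs <;> simp [coeff_one]

theorem eq_zero_of_kingNbrs {a b : R} {f : ℕ × ℕ → R⟦X⟧}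
    (hf : ∀ p, f p = X * (C (visitWeight a b p) * ∑ q ∈ kingNbrs p, f q)) (p : ℕ × ℕ) :
    f p = 0 := by
  have h : ∀ (n : ℕ) (p : ℕ × ℕ), X ^ n ∣ f p := fun n => by
    induction n with
    | zero => simp
    | succ n ih =>
      intro p
      rw [hf p, pow_succ']
      exact mul_dvd_mul_left _ (Dvd.dvd.mul_left (Finset.dvd_sum fun q _ => ih q) _)
  ext n
  exact X_pow_dvd_iff.1 (h (n + 1) p) n n.lt_succ_self

/-- The excursions of the product model determine those of the interacting model. -/
theorem loopGF_mul_eq {a b : R} {s sa sb : R⟦X⟧}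
    (hs : s * (1 + X) = 1) (hsa : sa * (1 + C a * X) = 1) (hsb : sb * (1 + C b * X) = 1)
    {e : ℕ → ℕ → R⟦X⟧} (he : ∀ i j, e i j = (if i = 0 ∧ j = 0 then 1 else 0) +
        X * s * (if j = 0 then C a * (1 + X) * sa else 1) *
          (if i = 0 then C b * (1 + X) * sb else 1) *
          ∑ k ∈ Finset.Icc (i - 1) (i + 1), ∑ l ∈ Finset.Icc (j - 1) (j + 1), e k l) :
    ((1 + C a * X) * (1 + C b * X) + X * (1 - C a) * (1 - C b) * e 0 0) * loopGF kingSteps a b =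
      (1 + X) * e 0 0 := by
  set κ := s * ((1 + C a * X) * (1 + C b * X) + X * (1 - C a) * (1 - C b) * e 0 0) with hκ
  have hG : loopGF kingSteps a b = kingGF a b (0, 0) := by
    ext n
    rw [coeff_loopGF_kingSteps, kingGF, coeff_mk]
  have hsum : ∀ i j, ∑ k ∈ Finset.Icc (i - 1) (i + 1), ∑ l ∈ Finset.Icc (j - 1) (j + 1), e k l =
      e i j + ∑ q ∈ kingNbrs (i, j), e q.1 q.2 := fun i j => by
    have hm : (i, j) ∈ Finset.Icc (i - 1) (i + 1) ×ˢ Finset.Icc (j - 1) (j + 1) := by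
      simp only [Finset.mem_product, Finset.mem_Icc]
      omega
    rw [← Finset.sum_product' (f := e)]
    exact (Finset.add_sum_erase _ (fun q : ℕ × ℕ => e q.1 q.2) hm).symm
  have he' : ∀ p : ℕ × ℕ, e p.1 p.2 = (if p = (0, 0) then κ else 0) +
      X * (C (visitWeight a b p) * ∑ q ∈ kingNbrs p, e q.1 q.2) := by
    rintro ⟨i, j⟩
    have h := he i j
    rw [hsum] at h
    generalize ∑ q ∈ kingNbrs (i, j), e q.1 q.2 = T at h ⊢
    by_cases hi : i = 0 <;> by_cases hj : j = 0
    · subst hi hj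
      simp only [visitWeight, and_self, if_true, map_mul, hκ] at h ⊢
      generalize e 0 0 = E at h ⊢
      linear_combination s * (1 + C a * X) * (1 + C b * X) * h +
        (X * C a * C b * (E + T) * (s * (1 + X) + 1) * (sa * (1 + C a * X)) * (sb * (1 + C b * X)) -
          E * (1 + C a * C b * X)) * hs +
        X * C a * C b * (E + T) * (sb * (1 + C b * X) * hsa + hsb)
    · simp only [visitWeight, hi, hj, Prod.mk.injEq, and_false, if_true, if_false, mul_one,
        one_mul, zero_add] at h ⊢
      generalize e 0 j = E at h ⊢
      linear_combination (1 + C b * X) * h + X * C b * (E + T) * (sb * (1 + C b * X) * hs + hsb)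
    · simp only [visitWeight, hi, hj, Prod.mk.injEq, false_and, if_true, if_false, mul_one,
        zero_add] at h ⊢
      generalize e i 0 = E at h ⊢
      linear_combination (1 + C a * X) * h + X * C a * (E + T) * (sa * (1 + C a * X) * hs + hsa)
    · simp only [visitWeight, hi, hj, Prod.mk.injEq, false_and, if_false, map_one, mul_one,
        one_mul, zero_add] at h ⊢
      generalize e i j = E at h ⊢
      linear_combination (1 + X) * h + X * (E + T) * hs
  have hzero := eq_zero_of_kingNbrs (a := a) (b := b)
    (f := fun p => e p.1 p.2 - κ * kingGF a b p) (fun p => by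
      simp only [Finset.sum_sub_distrib, ← Finset.mul_sum]
      rw [he' p, kingGF_eq a b p]
      split_ifs <;> ring) (0, 0)
  simp only at hzero
  rw [hG]
  linear_combination -(1 + X) * hzero -
    ((1 + C a * X) * (1 + C b * X) + X * (1 - C a) * (1 - C b) * e 0 0) *
      kingGF a b (0, 0) * hs

end KingWalks

section MainResult

variable {R : Type*} [CommRing R]

theorem exists_mul_one_add_C_mul_X (a : R) : ∃ s : R⟦X⟧, s * (1 + C a * X) = 1 := by
  obtain ⟨u, hu⟩ : IsUnit (1 + C a * X : R⟦X⟧) := by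
    rw [isUnit_iff_constantCoeff]
    simp
  exact ⟨↑u⁻¹, by rw [← hu, Units.inv_mul]⟩

theorem constX_one_add_X_mem [IsDomain R] :
    constX (1 + X : R⟦X⟧) ∈ ratSubring (polySubring R) := by
  have h := constX_mem_ratSubring (1 + Polynomial.X : Polynomial R)
  rwa [Polynomial.coe_add, Polynomial.coe_one, Polynomial.coe_X] at h

variable [IsDomain R] [CharZero R]

/-- The excursion series of king walks is a ratio of D-finite series, whose denominator is the
rational function `(1 + a t) (1 + b t)` when `(1 - a) (1 - b) = 0`. -/
theorem loopGF_kingSteps_ratio (a b : R) : ∃ E : R⟦X⟧,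
    ((1 + C a * X) * (1 + C b * X) + X * (1 - C a) * (1 - C b) * E) * loopGF kingSteps a b =
      (1 + X) * E ∧
    ∀ f g : R⟦X⟧, constX f ∈ ratSubring (polySubring R) →
      constX g ∈ ratSubring (polySubring R) → IsDFinite (f + g * E) := by
  obtain ⟨sa, hsa⟩ := exists_mul_one_add_C_mul_X a
  obtain ⟨sb, hsb⟩ := exists_mul_one_add_C_mul_X b
  obtain ⟨s, hs⟩ := exists_mul_one_add_C_mul_X (1 : R)
  rw [map_one, one_mul] at hs
  obtain ⟨e, he, hdf⟩ := exists_dfinite_product_model a b hs hsa hsb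
  exact ⟨e 0 0, loopGF_mul_eq hs hsa hsb he, hdf⟩

theorem isDFinite_loopGF_kingSteps {a b : R} (h : (1 - a) * (1 - b) = 0) :
    IsDFinite (loopGF kingSteps a b) := by
  obtain ⟨E, hE, hdf⟩ := loopGF_kingSteps_ratio a b
  obtain ⟨sa, hsa⟩ := exists_mul_one_add_C_mul_X a
  obtain ⟨sb, hsb⟩ := exists_mul_one_add_C_mul_X b
  have hC : (1 - C a : R⟦X⟧) * (1 - C b) = 0 := by
    simpa using congrArg (C : R →+* R⟦X⟧) h
  have hG : loopGF kingSteps a b = 0 + sa * sb * (1 + X) * E := by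
    linear_combination sa * sb * hE - sa * sb * X * E * loopGF kingSteps a b * hC -
      loopGF kingSteps a b * (sb * (1 + C b * X) * hsa + hsb)
  have hinv : ∀ {r : R} {q : R⟦X⟧}, q * (1 + C r * X) = 1 →
      constX q ∈ ratSubring (polySubring R) := fun {r q} hq =>
    constX_mem_of_mul_eq_one (1 + Polynomial.C r * Polynomial.X) (by simpa using hq)
  rw [hG]
  refine hdf 0 (sa * sb * (1 + X)) ?_ ?_
  · rw [map_zero]
    exact zero_mem _
  · rw [map_mul, map_mul]
    exact mul_mem (mul_mem (hinv hsa) (hinv hsb)) constX_one_add_X_mem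

theorem exists_dfinite_ratio_loopGF_kingSteps (a b : R) : ∃ F H : R⟦X⟧,
    IsDFinite F ∧ IsDFinite H ∧ H ≠ 0 ∧ H * loopGF kingSteps a b = F := by
  obtain ⟨E, hE, hdf⟩ := loopGF_kingSteps_ratio a b
  refine ⟨(1 + X) * E, (1 + C a * X) * (1 + C b * X) + X * (1 - C a) * (1 - C b) * E, ?_,
    hdf ((1 + C a * X) * (1 + C b * X)) (X * (1 - C a) * (1 - C b)) ?_ ?_, fun h => ?_, hE⟩
  · have h := hdf 0 (1 + X) (by rw [map_zero]; exact zero_mem _) constX_one_add_X_mem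
    rwa [zero_add] at h
  · have h := constX_mem_ratSubring
      ((1 + Polynomial.C a * Polynomial.X) * (1 + Polynomial.C b * Polynomial.X))
    simpa only [Polynomial.coe_add, Polynomial.coe_mul, Polynomial.coe_one, Polynomial.coe_X,
      Polynomial.coe_C] using h
  · have h := constX_mem_ratSubring
      (Polynomial.X * (1 - Polynomial.C a) * (1 - Polynomial.C b))
    simpa only [Polynomial.coe_sub, Polynomial.coe_mul, Polynomial.coe_one, Polynomial.coe_X,
      Polynomial.coe_C] using h
  · have h' := congrArg constantCoeff h
    simp at h'

end MainResult

/-- Model 3 (all eight short steps): `G(t;a,1)` and `G(t;1,b)` are D-finite, and `G(t;a,b)` is a ratio of D-finite series. -/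
theorem model3_dfinite_and_ratio :
    IsDFinite (loopGF ({((1:ℤ), (0:ℤ)), (-1, 0), (0, 1), (0, -1), (1, 1), (1, -1), (-1, 1), (-1, -1)} : Set (ℤ × ℤ)) (Polynomial.X : Polynomial ℚ) 1) ∧
    IsDFinite (loopGF ({((1:ℤ), (0:ℤ)), (-1, 0), (0, 1), (0, -1), (1, 1), (1, -1), (-1, 1), (-1, -1)} : Set (ℤ × ℤ)) (1 : Polynomial ℚ) Polynomial.X) ∧
    ∃ F H : PowerSeries (MvPolynomial (Fin 2) ℚ),
      IsDFinite F ∧ IsDFinite H ∧ H ≠ 0 ∧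
      H * loopGF ({((1:ℤ), (0:ℤ)), (-1, 0), (0, 1), (0, -1), (1, 1), (1, -1), (-1, 1), (-1, -1)} : Set (ℤ × ℤ))
        (MvPolynomial.X (0 : Fin 2)) (MvPolynomial.X (1 : Fin 2)) = F := by
  exact ⟨isDFinite_loopGF_kingSteps (by simp), isDFinite_loopGF_kingSteps (by simp),
    exists_dfinite_ratio_loopGF_kingSteps _ _⟩
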